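/- Let T be an unbounded selfadjoint operator in H (densely defined, T = T*, and T is not bounded, i.e. there is no C with ‖Tx‖ ≤ C‖x‖ for all x ∈ dom(T)). Then: (a) if the set of real numbers {⟨Tx, x⟩ : x ∈ dom(T), ‖x‖ = 1} is bounded neither from below nor from above, then W_e(T) = ℝ (viewed as a subset of ℂ); (b) if this set is bounded from below, then W_e(T) = {λ ∈ ℂ : λ ∈ ℝ and λ ≥ inf{Re μ : μ ∈ σ_e(T)}} when σ_e(T) ≠ ∅, and W_e(T) = ∅ when σ_e(T) = ∅; (c) if this set is bounded from above, then W_e(T) = {λ ∈ ℂ : λ ∈ ℝ and λ ≤ sup{Re μ : μ ∈ σ_e(T)}} when σ_e(T) ≠ ∅, and W_e(T) = ∅ when σ_e(T) = ∅. -/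

import Mathlib

open Filter Topology

noncomputable section

variable {H : Type*} [NormedAddCommGroup H] [InnerProductSpace ℂ H] [CompleteSpace H]

/-- A sequence in an inner product space converges weakly to zero. -/
def WeakNull {E : Type*} [NormedAddCommGroup E] [InnerProductSpace ℂ E] (x : ℕ → E) : Prop :=
  ∀ y : E, Tendsto (fun n => (inner ℂ (x n) y : ℂ)) atTop (nhds 0)

/-- The numerical range of a (possibly unbounded) linear operator `T` in `H`,
`W(T) = {⟨Tx, x⟩ : x ∈ dom T, ‖x‖ = 1}`. -/
def numRange (T : H →ₗ.[ℂ] H) : Set ℂ :=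
  {z | ∃ x : T.domain, ‖(x : H)‖ = 1 ∧ (inner ℂ ((x : H)) (T x) : ℂ) = z}

/-- The essential numerical range of a (possibly unbounded) linear operator `T` in `H`. -/
def essNumRange (T : H →ₗ.[ℂ] H) : Set ℂ :=
  {z | ∃ x : ℕ → T.domain, (∀ n, ‖((x n : H))‖ = 1) ∧
    WeakNull (fun n => ((x n : H))) ∧
    Tendsto (fun n => (inner ℂ ((x n : H)) (T (x n)) : ℂ)) atTop (nhds z)}

/-- The essential spectrum `σ_e(T)` (the version `σ_{e2}` via singular Weyl sequences). -/
def essSpec (T : H →ₗ.[ℂ] H) : Set ℂ :=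
  {z | ∃ x : ℕ → T.domain, (∀ n, ‖((x n : H))‖ = 1) ∧
    WeakNull (fun n => ((x n : H))) ∧
    Tendsto (fun n => ‖T (x n) - z • ((x n : H))‖) atTop (nhds 0)}

/-- The set `{⟨Tx, x⟩ : x ∈ dom T, ‖x‖ = 1} ⊆ ℝ` for a symmetric/selfadjoint operator. -/
def realNumRange (T : H →ₗ.[ℂ] H) : Set ℝ :=
  {r | ∃ x : T.domain, ‖(x : H)‖ = 1 ∧ (inner ℂ ((x : H)) (T x) : ℂ).re = r}

set_option linter.unusedSectionVars false

/-- Symmetry of an operator. -/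
def SymmOp (T : H →ₗ.[ℂ] H) : Prop :=
  ∀ x y : T.domain, (inner ℂ (T x) (y : H) : ℂ) = inner ℂ (x : H) (T y)

/-- Maximality: the adjoint is contained in the operator. -/
def MaxOp (T : H →ₗ.[ℂ] H) : Prop :=
  ∀ y w : H, (∀ x : T.domain, (inner ℂ w (x : H) : ℂ) = inner ℂ y (T x)) →
    ∃ h : y ∈ T.domain, T ⟨y, h⟩ = w

/-- The quadratic form. -/
def qf (T : H →ₗ.[ℂ] H) (x : T.domain) : ℝ := (inner ℂ (x : H) (T x) : ℂ).re

theorem inner_eq_qf {T : H →ₗ.[ℂ] H} (hs : SymmOp T) (x : T.domain) :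
    (inner ℂ (x : H) (T x) : ℂ) = (qf T x : ℂ) := by
  have h1 := hs x x
  rw [← inner_conj_symm] at h1
  exact (Complex.conj_eq_iff_re.mp h1).symm

theorem qf_add_smul {T : H →ₗ.[ℂ] H} (hs : SymmOp T) (x y : T.domain) (t : ℝ) :
    qf T (x + (t : ℂ) • y) = qf T x + 2 * t * (inner ℂ (T x) (y : H) : ℂ).re + t ^ 2 * qf T y := by
  have h1 : (inner ℂ (y : H) (T x) : ℂ).re = (inner ℂ (T x) (y : H) : ℂ).re := by
    exact inner_re_symm (𝕜 := ℂ) _ _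
  have h2 := hs x y
  unfold qf
  rw [LinearPMap.map_add, LinearPMap.map_smul]
  simp only [Submodule.coe_add, Submodule.coe_smul, inner_add_left, inner_add_right,
    inner_smul_left, inner_smul_right, ← h2, Complex.add_re, Complex.conj_ofReal,
    Complex.re_ofReal_mul, h1]
  ring

theorem qf_smul (T : H →ₗ.[ℂ] H) (x : T.domain) (t : ℝ) :
    qf T ((t : ℂ) • x) = t ^ 2 * qf T x := by
  unfold qf
  rw [LinearPMap.map_smul]
  simp only [Submodule.coe_smul, inner_smul_left, inner_smul_right, Complex.conj_ofReal,
    Complex.re_ofReal_mul]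
  ring

/-- Cauchy-Schwarz inequality for the shifted form. -/
theorem cs_form {T : H →ₗ.[ℂ] H} (hs : SymmOp T) (b : ℝ)
    (hb : ∀ x : T.domain, 0 ≤ qf T x + b * ‖(x : H)‖ ^ 2) (x y : T.domain) :
    ((inner ℂ (T x) (y : H) : ℂ).re + b * (inner ℂ (x : H) (y : H) : ℂ).re) ^ 2 ≤
      (qf T x + b * ‖(x : H)‖ ^ 2) * (qf T y + b * ‖(y : H)‖ ^ 2) := by
  have key : ∀ t : ℝ, 0 ≤ (qf T y + b * ‖(y : H)‖ ^ 2) * (t * t) +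
      (2 * ((inner ℂ (T x) (y : H) : ℂ).re + b * (inner ℂ (x : H) (y : H) : ℂ).re)) * t +
      (qf T x + b * ‖(x : H)‖ ^ 2) := by
    intro t
    have h := hb (x + (t : ℂ) • y)
    rw [qf_add_smul hs] at h
    have hn : ‖((x + (t : ℂ) • y : T.domain) : H)‖ ^ 2 =
        ‖(x : H)‖ ^ 2 + 2 * t * (inner ℂ (x : H) (y : H) : ℂ).re + t ^ 2 * ‖(y : H)‖ ^ 2 := by
      rw [Submodule.coe_add, Submodule.coe_smul, @norm_add_sq ℂ]
      simp only [inner_smul_right, norm_smul, RCLike.re_to_complex, Complex.re_ofReal_mul,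
        mul_pow, Complex.norm_real, Real.norm_eq_abs, sq_abs]
      ring
    rw [hn] at h
    nlinarith [h]
  have := discrim_le_zero key
  rw [discrim] at this
  nlinarith [this]

theorem qf_lower {T : H →ₗ.[ℂ] H} {c : ℝ} (hc : ∀ r ∈ realNumRange T, c ≤ r) (x : T.domain) :
    c * ‖(x : H)‖ ^ 2 ≤ qf T x := by
  by_cases hx : (x : H) = 0
  · have : x = 0 := Subtype.ext hx
    subst this
    simp [qf]
  · have hn : 0 < ‖(x : H)‖ := norm_pos_iff.mpr hx
    have h := hc (qf T (((‖(x : H)‖⁻¹ : ℝ) : ℂ) • x)) ⟨_, by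
      simp [norm_smul, hn.ne'], rfl⟩
    rw [qf_smul] at h
    have h2 := mul_le_mul_of_nonneg_right h (sq_nonneg ‖(x : H)‖)
    calc _ ≤ _ := h2
      _ = qf T x := by field_simp

theorem qf_upper {T : H →ₗ.[ℂ] H} {c : ℝ} (hc : ∀ r ∈ realNumRange T, r ≤ c) (x : T.domain) :
    qf T x ≤ c * ‖(x : H)‖ ^ 2 := by
  by_cases hx : (x : H) = 0
  · have : x = 0 := Subtype.ext hx
    subst this
    simp [qf]
  · have hn : 0 < ‖(x : H)‖ := norm_pos_iff.mpr hx
    have h := hc (qf T (((‖(x : H)‖⁻¹ : ℝ) : ℂ) • x)) ⟨_, by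
      simp [norm_smul, hn.ne'], rfl⟩
    rw [qf_smul] at h
    have h2 := mul_le_mul_of_nonneg_right h (sq_nonneg ‖(x : H)‖)
    calc qf T x = _ := by field_simp
      _ ≤ _ := h2

theorem bounded_of_bdd {T : H →ₗ.[ℂ] H} (hs : SymmOp T) (hdense : Dense (T.domain : Set H))
    (h1 : BddBelow (realNumRange T)) (h2 : BddAbove (realNumRange T)) :
    ∃ C : ℝ, ∀ x : T.domain, ‖T x‖ ≤ C * ‖(x : H)‖ := by
  obtain ⟨c, hc⟩ := h1
  obtain ⟨d, hd⟩ := h2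
  have hl := qf_lower (T := T) (c := c) (fun r hr => hc hr)
  have hu := qf_upper (T := T) (c := d) (fun r hr => hd hr)
  refine ⟨|d - c| + |c|, fun x => ?_⟩
  have key : ∀ y : H, (inner ℂ (T x - (c : ℂ) • (x : H)) y : ℂ).re ≤ |d - c| * ‖(x : H)‖ * ‖y‖ := by
    have hcl : IsClosed {y : H | (inner ℂ (T x - (c : ℂ) • (x : H)) y : ℂ).re ≤
        |d - c| * ‖(x : H)‖ * ‖y‖} := isClosed_le (by fun_prop) (by fun_prop)
    intro y
    have hsub : (T.domain : Set H) ⊆ {y : H | (inner ℂ (T x - (c : ℂ) • (x : H)) y : ℂ).re ≤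
        |d - c| * ‖(x : H)‖ * ‖y‖} := by
      intro y hy
      have := cs_form hs (-c) (fun z => by linarith [hl z]) x ⟨y, hy⟩
      have e1 : qf T x + -c * ‖(x : H)‖ ^ 2 ≤ |d - c| * ‖(x : H)‖ ^ 2 := by
        nlinarith [hu x, le_abs_self (d - c), sq_nonneg ‖(x : H)‖]
      have e2 : qf T ⟨y, hy⟩ + -c * ‖y‖ ^ 2 ≤ |d - c| * ‖y‖ ^ 2 := by
        have := hu ⟨y, hy⟩
        simp only at this
        nlinarith [le_abs_self (d - c), sq_nonneg ‖y‖]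
      have e3 : 0 ≤ qf T ⟨y, hy⟩ + -c * ‖y‖ ^ 2 := by linarith [hl ⟨y, hy⟩]
      simp only [Set.mem_ofPred_eq, inner_sub_left, inner_smul_left, Complex.sub_re,
        Complex.conj_ofReal, Complex.re_ofReal_mul]
      apply le_of_sq_le_sq _ (by positivity)
      calc _ = _ := by ring
        _ ≤ _ := this
        _ ≤ (|d - c| * ‖(x : H)‖ ^ 2) * (|d - c| * ‖y‖ ^ 2) :=
          mul_le_mul e1 e2 e3 (by positivity)
        _ = _ := by ring
    exact (hcl.closure_subset_iff.mpr hsub) (hdense y)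
  have h := key (T x - (c : ℂ) • (x : H))
  rw [inner_self_eq_norm_sq_to_K] at h
  have h' : ‖T x - (c : ℂ) • (x : H)‖ ^ 2 ≤
      |d - c| * ‖(x : H)‖ * ‖T x - (c : ℂ) • (x : H)‖ := by
    refine le_trans (le_of_eq ?_) h
    rw [← RCLike.ofReal_pow]
    exact (Complex.ofReal_re _).symm
  have h3 : ‖T x - (c : ℂ) • (x : H)‖ ≤ |d - c| * ‖(x : H)‖ := by
    by_contra hcon
    push Not at hcon
    have : 0 < ‖T x - (c : ℂ) • (x : H)‖ := lt_of_le_of_lt (by positivity) hcon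
    nlinarith
  calc ‖T x‖ = ‖(T x - (c : ℂ) • (x : H)) + (c : ℂ) • (x : H)‖ := by rw [sub_add_cancel]
    _ ≤ ‖T x - (c : ℂ) • (x : H)‖ + ‖(c : ℂ) • (x : H)‖ := norm_add_le _ _
    _ ≤ _ := by
      rw [norm_smul, Complex.norm_real, Real.norm_eq_abs]
      linarith

/-- Perturbation lemma. -/
theorem perturb {T : H →ₗ.[ℂ] H} (hs : SymmOp T) (hub : ¬ BddAbove (realNumRange T))
    (x : T.domain) (hx : ‖(x : H)‖ = 1) (μ : ℝ) (hμ : qf T x ≤ μ) (ε : ℝ) (hε : 0 < ε) :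
    ∃ z : T.domain, ‖(z : H)‖ = 1 ∧ ‖(z : H) - (x : H)‖ < ε ∧ |qf T z - μ| < ε := by
  have hy : ∀ m : ℕ, ∃ y : T.domain, ‖(y : H)‖ = 1 ∧ (m : ℝ) + 1 ≤ qf T y := by
    intro m
    by_contra hcon
    push Not at hcon
    apply hub
    refine ⟨m + 1, ?_⟩
    rintro r ⟨y, hy, rfl⟩
    exact (hcon y hy).le
  choose y hy1 hy2 using hy
  have hpos : ∀ m, 0 < qf T (y m) := fun m => lt_of_lt_of_le (by positivity) (hy2 m)
  set d := μ - qf T x with hd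
  have hd0 : 0 ≤ d := by linarith
  set t : ℕ → ℝ := fun m => Real.sqrt (d / qf T (y m)) with ht
  have ht2 : ∀ m, t m ^ 2 * qf T (y m) = d := by
    intro m
    simp only [ht]
    rw [Real.sq_sqrt (div_nonneg hd0 (hpos m).le), div_mul_cancel₀ _ (hpos m).ne']
  have hq : Tendsto (fun m => qf T (y m)) atTop atTop := by
    refine tendsto_atTop_mono hy2 ?_
    exact tendsto_atTop_add_const_right _ _ tendsto_natCast_atTop_atTop
  have htlim : Tendsto t atTop (𝓝 0) := by
    have : Tendsto (fun m => d / qf T (y m)) atTop (𝓝 0) := hq.const_div_atTop d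
    have := this.sqrt
    simpa using this
  have hty : Tendsto (fun m => (t m : ℂ) • ((y m : T.domain) : H)) atTop (𝓝 0) := by
    rw [tendsto_zero_iff_norm_tendsto_zero]
    simpa [norm_smul, hy1] using htlim.abs
  set v : ℕ → T.domain := fun m => x + (t m : ℂ) • y m with hv
  have hvlim : Tendsto (fun m => ((v m : T.domain) : H)) atTop (𝓝 (x : H)) := by
    simpa [hv] using hty.const_add (x : H)
  have hnlim : Tendsto (fun m => ‖((v m : T.domain) : H)‖) atTop (𝓝 1) := by
    simpa [hx] using hvlim.norm
  have hcross : Tendsto (fun m => 2 * t m * (inner ℂ (T x) ((y m : T.domain) : H) : ℂ).re)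
      atTop (𝓝 0) := by
    refine squeeze_zero_norm (a := fun m => 2 * |t m| * ‖T x‖) ?_ ?_
    · intro m
      rw [norm_mul, norm_mul]
      have : ‖(inner ℂ (T x) ((y m : T.domain) : H) : ℂ).re‖ ≤ ‖T x‖ := by
        refine (Complex.abs_re_le_norm _).trans ((norm_inner_le_norm _ _).trans ?_)
        rw [hy1, mul_one]
      simp only [Real.norm_eq_abs, Nat.abs_ofNat] at this ⊢
      gcongr
    · have := (htlim.abs.const_mul 2).mul_const ‖T x‖
      simpa using this
  have hqlim : Tendsto (fun m => qf T (v m)) atTop (𝓝 μ) := by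
    have : (fun m => qf T (v m)) = fun m =>
        μ + 2 * t m * (inner ℂ (T x) ((y m : T.domain) : H) : ℂ).re := by
      funext m
      simp only [hv]
      rw [qf_add_smul hs, ht2]
      ring
    rw [this]
    simpa using hcross.const_add μ
  have hilim : Tendsto (fun m => ‖((v m : T.domain) : H)‖⁻¹) atTop (𝓝 1) := by
    simpa using hnlim.inv₀ one_ne_zero
  have hz1 : Tendsto (fun m => (((‖((v m : T.domain) : H)‖⁻¹ : ℝ) : ℂ) • v m : T.domain).1)
      atTop (𝓝 (x : H)) := by
    have := ((Complex.continuous_ofReal.tendsto _).comp hilim).smul hvlim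
    simpa using this
  have hz2 : Tendsto (fun m => qf T (((‖((v m : T.domain) : H)‖⁻¹ : ℝ) : ℂ) • v m))
      atTop (𝓝 μ) := by
    simp only [qf_smul]
    simpa using (hilim.pow 2).mul hqlim
  have ev1 := (Metric.tendsto_nhds.mp hz1) ε hε
  have ev2 := (Metric.tendsto_nhds.mp hz2) ε hε
  have ev3 : ∀ᶠ m in atTop, 0 < ‖((v m : T.domain) : H)‖ := hnlim.eventually_const_lt one_pos
  obtain ⟨m, h1, h2, h3⟩ := (ev1.and (ev2.and ev3)).exists
  refine ⟨((‖((v m : T.domain) : H)‖⁻¹ : ℝ) : ℂ) • v m, ?_, ?_, ?_⟩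
  · simp [norm_smul, h3.ne']
  · rwa [dist_eq_norm] at h1
  · rwa [Real.dist_eq] at h2

theorem weakNull_of_dense {D : ℕ → H} (hD : DenseRange D) (x : ℕ → H) (C : ℝ)
    (hb : ∀ n, ‖x n‖ ≤ C)
    (h : ∀ k, Tendsto (fun n => (inner ℂ (x n) (D k) : ℂ)) atTop (𝓝 0)) : WeakNull x := by
  intro y
  have hC : 0 ≤ C := (norm_nonneg _).trans (hb 0)
  rw [Metric.tendsto_nhds]
  intro ε hε
  obtain ⟨k, hk⟩ := hD.exists_dist_lt y (ε := ε / (2 * (C + 1))) (by positivity)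
  filter_upwards [(Metric.tendsto_nhds.mp (h k)) (ε / 2) (by positivity)] with n hn
  rw [dist_zero_right] at hn ⊢
  have e : (inner ℂ (x n) y : ℂ) = inner ℂ (x n) (D k) + inner ℂ (x n) (y - D k) := by
    rw [← inner_add_right]; congr 1; abel
  have e2 : ‖(inner ℂ (x n) (y - D k) : ℂ)‖ ≤ C * (ε / (2 * (C + 1))) := by
    refine (norm_inner_le_norm _ _).trans ?_
    rw [dist_eq_norm] at hk
    exact mul_le_mul (hb n) hk.le (norm_nonneg _) hC
  have e3 : C * (ε / (2 * (C + 1))) ≤ ε / 2 := by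
    rw [mul_div_assoc', div_le_div_iff₀ (by positivity) (by positivity)]
    nlinarith
  rw [e]
  calc _ ≤ _ := norm_add_le _ _
    _ < ε := by linarith

theorem mem_essNumRange_iff [TopologicalSpace.SeparableSpace H] (T : H →ₗ.[ℂ] H) (z : ℂ) :
    z ∈ essNumRange T ↔ ∀ (F : Finset H) (ε : ℝ), 0 < ε → ∃ x : T.domain, ‖(x : H)‖ = 1 ∧
      (∀ f ∈ F, ‖(inner ℂ (x : H) f : ℂ)‖ < ε) ∧ ‖(inner ℂ (x : H) (T x) : ℂ) - z‖ < ε := by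
  classical
  constructor
  · rintro ⟨x, hx1, hx2, hx3⟩ F ε hε
    have h1 : ∀ᶠ n in atTop, ∀ f ∈ F, ‖(inner ℂ ((x n : T.domain) : H) f : ℂ)‖ < ε := by
      rw [Filter.eventually_all_finset]
      intro f _
      filter_upwards [(Metric.tendsto_nhds.mp (hx2 f)) ε hε] with n hn
      rwa [dist_zero_right] at hn
    have h2 := (Metric.tendsto_nhds.mp hx3) ε hε
    obtain ⟨n, hn1, hn2⟩ := (h1.and h2).exists
    exact ⟨x n, hx1 n, hn1, by rwa [dist_eq_norm] at hn2⟩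
  · intro h
    have h' := fun n : ℕ => h ((Finset.range (n + 1)).image (TopologicalSpace.denseSeq H))
      (1 / ((n : ℝ) + 1)) (by positivity)
    choose x hx1 hx2 hx3 using h'
    refine ⟨x, hx1, ?_, ?_⟩
    · refine weakNull_of_dense (TopologicalSpace.denseRange_denseSeq H) _ 1
        (fun n => (hx1 n).le) ?_
      intro k
      rw [tendsto_zero_iff_norm_tendsto_zero]
      refine squeeze_zero' (Eventually.of_forall fun n => norm_nonneg _) ?_
        tendsto_one_div_add_atTop_nhds_zero_nat
      filter_upwards [eventually_ge_atTop k] with n hn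
      exact (hx2 n _ (Finset.mem_image_of_mem _ (Finset.mem_range.mpr (by omega)))).le
    · rw [tendsto_iff_norm_sub_tendsto_zero]
      exact squeeze_zero (fun n => norm_nonneg _) (fun n => (hx3 n).le)
        tendsto_one_div_add_atTop_nhds_zero_nat

theorem isClosed_essNumRange [TopologicalSpace.SeparableSpace H] (T : H →ₗ.[ℂ] H) :
    IsClosed (essNumRange T) := by
  rw [← closure_subset_iff_isClosed]
  intro z hz
  rw [mem_essNumRange_iff]
  intro F ε hε
  obtain ⟨w, hw, hzw⟩ := Metric.mem_closure_iff.mp hz (ε / 2) (by positivity)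
  obtain ⟨x, h1, h2, h3⟩ := (mem_essNumRange_iff T w).mp hw F (ε / 2) (by positivity)
  refine ⟨x, h1, fun f hf => (h2 f hf).trans (by linarith), ?_⟩
  rw [dist_comm, dist_eq_norm] at hzw
  calc _ = ‖((inner ℂ (x : H) (T x) : ℂ) - w) + (w - z)‖ := by congr 1; ring
    _ ≤ _ := norm_add_le _ _
    _ < ε := by linarith

theorem essNumRange_im {T : H →ₗ.[ℂ] H} (hs : SymmOp T) {z : ℂ} (hz : z ∈ essNumRange T) :
    z.im = 0 := by
  obtain ⟨x, -, -, h⟩ := hz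
  have h1 := (Complex.continuous_im.tendsto z).comp h
  have h2 : (Complex.im ∘ fun n => (inner ℂ ((x n : T.domain) : H) (T (x n)) : ℂ)) =
      fun _ => (0 : ℝ) := by
    funext n
    simp only [Function.comp, inner_eq_qf hs, Complex.ofReal_im]
  rw [h2] at h1
  exact tendsto_nhds_unique h1 tendsto_const_nhds

theorem essSpec_subset (T : H →ₗ.[ℂ] H) : essSpec T ⊆ essNumRange T := by
  rintro z ⟨x, h1, h2, h3⟩
  refine ⟨x, h1, h2, ?_⟩
  rw [tendsto_iff_norm_sub_tendsto_zero]
  refine squeeze_zero (fun n => norm_nonneg _) (fun n => ?_) h3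
  have e : (inner ℂ ((x n : T.domain) : H) (T (x n)) : ℂ) - z =
      inner ℂ ((x n : T.domain) : H) (T (x n) - z • ((x n : T.domain) : H)) := by
    rw [inner_sub_right, inner_smul_right, inner_self_eq_norm_sq_to_K, h1]
    simp
  rw [e]
  refine (norm_inner_le_norm _ _).trans ?_
  rw [h1, one_mul]

theorem essNumRange_lower {T : H →ₗ.[ℂ] H} {c : ℝ} (hc : ∀ r ∈ realNumRange T, c ≤ r)
    {z : ℂ} (hz : z ∈ essNumRange T) : c ≤ z.re := by
  obtain ⟨x, h1, -, h⟩ := hz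
  have h2 := (Complex.continuous_re.tendsto z).comp h
  exact ge_of_tendsto' h2 (fun n => hc _ ⟨x n, h1 n, rfl⟩)

/-- replace a nearby vector -/
theorem inner_close {x z f : H} {ε δ : ℝ} (h1 : ‖(inner ℂ x f : ℂ)‖ < ε) (h2 : ‖z - x‖ < δ)
    {M : ℝ} (hM : ‖f‖ ≤ M) (hM0 : 0 < M) : ‖(inner ℂ z f : ℂ)‖ < ε + δ * M := by
  have e : (inner ℂ z f : ℂ) = inner ℂ x f + inner ℂ (z - x) f := by
    rw [← inner_add_left]; congr 1; abel
  have h3 : ‖(inner ℂ (z - x) f : ℂ)‖ ≤ δ * M := by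
    refine (norm_inner_le_norm _ _).trans ?_
    exact mul_le_mul h2.le hM (norm_nonneg _) ((norm_nonneg _).trans h2.le)
  rw [e]
  calc _ ≤ _ := norm_add_le _ _
    _ < _ := by linarith

theorem exists_norm_bound (F : Finset H) : ∃ M : ℝ, 1 ≤ M ∧ ∀ f ∈ F, ‖f‖ ≤ M := by
  refine ⟨1 + ∑ f ∈ F, ‖f‖, ?_, fun f hf => ?_⟩
  · linarith [Finset.sum_nonneg (fun f (_ : f ∈ F) => norm_nonneg f)]
  · linarith [Finset.single_le_sum (fun f (_ : f ∈ F) => norm_nonneg f) hf]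

/-- A perturbed version: if every test set has good x whose form can be moved to μ. -/
theorem mem_of_perturb [TopologicalSpace.SeparableSpace H] {T : H →ₗ.[ℂ] H} (hs : SymmOp T)
    (μ : ℝ)
    (h : ∀ (F : Finset H) (ε : ℝ), 0 < ε → ∃ x : T.domain,
      (∀ f ∈ F, ‖(inner ℂ (x : H) f : ℂ)‖ < ε) ∧
      ∀ δ : ℝ, 0 < δ → ∃ z : T.domain, ‖(z : H)‖ = 1 ∧ ‖(z : H) - (x : H)‖ < δ ∧
        |qf T z - μ| < ε + δ) :
    (μ : ℂ) ∈ essNumRange T := by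
  rw [mem_essNumRange_iff]
  intro F ε hε
  obtain ⟨M, hM1, hM⟩ := exists_norm_bound F
  obtain ⟨x, hx1, hx2⟩ := h F (ε / 2) (by positivity)
  have hM0 : 0 < M := by linarith
  obtain ⟨z, hz1, hz2, hz3⟩ := hx2 (ε / 2 / M) (by positivity)
  refine ⟨z, hz1, fun f hf => ?_, ?_⟩
  · have := inner_close (hx1 f hf) hz2 (hM f hf) hM0
    rw [div_mul_cancel₀ _ hM0.ne'] at this
    linarith
  · rw [inner_eq_qf hs, ← Complex.ofReal_sub, Complex.norm_real, Real.norm_eq_abs]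
    have : ε / 2 / M ≤ ε / 2 := div_le_self (by positivity) hM1
    linarith

theorem essNumRange_up [TopologicalSpace.SeparableSpace H] {T : H →ₗ.[ℂ] H} (hs : SymmOp T)
    (hub : ¬ BddAbove (realNumRange T)) {z : ℂ} (hz : z ∈ essNumRange T) {μ : ℝ}
    (hμ : z.re ≤ μ) : (μ : ℂ) ∈ essNumRange T := by
  apply mem_of_perturb hs
  intro F ε hε
  obtain ⟨x, h1, h2, h3⟩ := (mem_essNumRange_iff T z).mp hz F ε hε
  refine ⟨x, h2, fun δ hδ => ?_⟩
  have h4 : |qf T x - z.re| < ε := by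
    refine lt_of_le_of_lt ?_ h3
    exact Complex.abs_re_le_norm (inner ℂ (x : H) (T x) - z)
  obtain ⟨w, hw1, hw2, hw3⟩ := perturb hs hub x h1 (max μ (qf T x)) (le_max_right _ _) δ hδ
  refine ⟨w, hw1, hw2, ?_⟩
  have h5 : |max μ (qf T x) - μ| ≤ ε := by
    rw [abs_lt] at h4
    rw [abs_of_nonneg (by linarith [le_max_left μ (qf T x)])]
    rcases max_cases μ (qf T x) with ⟨h, _⟩ | ⟨h, _⟩ <;> rw [h] <;> linarith
  calc |qf T w - μ| = |(qf T w - max μ (qf T x)) + (max μ (qf T x) - μ)| := by congr 1; ring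
    _ ≤ _ := abs_add_le _ _
    _ < _ := by linarith

theorem exists_almost_orth (hinf : ¬FiniteDimensional ℂ H) {T : H →ₗ.[ℂ] H}
    (hdense : Dense (T.domain : Set H)) (F : Finset H) (ε : ℝ) (hε : 0 < ε) :
    ∃ x : T.domain, ‖(x : H)‖ = 1 ∧ ∀ f ∈ F, ‖(inner ℂ (x : H) f : ℂ)‖ < ε := by
  set V : Submodule ℂ H := Submodule.span ℂ (F : Set H) with hV
  have hfin : FiniteDimensional ℂ V := FiniteDimensional.span_finset ℂ F
  have hne : Vᗮ ≠ ⊥ := by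
    intro hbot
    rw [Submodule.orthogonal_eq_bot_iff] at hbot
    apply hinf
    rw [hbot] at hfin
    exact Module.Finite.equiv (Submodule.topEquiv (R := ℂ) (M := H))
  obtain ⟨u, huV, hu0⟩ := (Submodule.ne_bot_iff _).mp hne
  have hinner : ∀ f ∈ F, (inner ℂ u f : ℂ) = 0 := fun f hf =>
    (Submodule.mem_orthogonal' V u).mp huV f (Submodule.subset_span hf)
  -- the open condition
  have hopen : IsOpen {y : H | 0 < ‖y‖ ∧ ∀ f ∈ F, ‖(inner ℂ y f : ℂ)‖ < ε * ‖y‖} := by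
    have : {y : H | 0 < ‖y‖ ∧ ∀ f ∈ F, ‖(inner ℂ y f : ℂ)‖ < ε * ‖y‖} =
        {y : H | 0 < ‖y‖} ∩ ⋂ f ∈ F, {y : H | ‖(inner ℂ y f : ℂ)‖ < ε * ‖y‖} := by
      ext y; simp
    rw [this]
    refine (isOpen_lt (by fun_prop) (by fun_prop)).inter ?_
    exact isOpen_biInter_finset fun f _ => isOpen_lt (by fun_prop) (by fun_prop)
  have hupos : 0 < ‖u‖ := norm_pos_iff.mpr hu0
  obtain ⟨y, ⟨hy1, hy2⟩, hyd⟩ := hdense.inter_open_nonempty _ hopen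
    ⟨u, hupos, fun f hf => by rw [hinner f hf, norm_zero]; positivity⟩
  refine ⟨((‖y‖⁻¹ : ℝ) : ℂ) • ⟨y, hyd⟩, ?_, fun f hf => ?_⟩
  · simp [norm_smul, hy1.ne']
  · rw [Submodule.coe_smul, inner_smul_left, norm_mul, Complex.conj_ofReal, Complex.norm_real,
      Real.norm_eq_abs, abs_of_pos (by positivity), inv_mul_lt_iff₀ hy1, mul_comm]
    exact hy2 f hf

/-! Negation -/

theorem symm_neg {T : H →ₗ.[ℂ] H} (hs : SymmOp T) : SymmOp (-T) := by
  intro x y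
  rw [LinearPMap.neg_apply, LinearPMap.neg_apply, inner_neg_left, inner_neg_right]
  exact congrArg _ (hs x y)

theorem max_neg {T : H →ₗ.[ℂ] H} (hm : MaxOp T) : MaxOp (-T) := by
  intro y w h
  obtain ⟨hy, hT⟩ := hm y (-w) (fun x => by
    have := h x
    rw [LinearPMap.neg_apply, inner_neg_right] at this
    rw [inner_neg_left, this, neg_neg])
  exact ⟨hy, by rw [LinearPMap.neg_apply]; exact neg_eq_iff_eq_neg.mpr hT⟩

theorem realNumRange_neg (T : H →ₗ.[ℂ] H) : realNumRange (-T) = -realNumRange T := by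
  ext r
  constructor
  · rintro ⟨x, h1, rfl⟩
    exact ⟨x, h1, by rw [LinearPMap.neg_apply, inner_neg_right, Complex.neg_re, neg_neg]⟩
  · rintro ⟨x, h1, h2⟩
    exact ⟨x, h1, by
      rw [LinearPMap.neg_apply, inner_neg_right, Complex.neg_re, neg_eq_iff_eq_neg]; exact h2⟩

theorem essNumRange_neg_mem {T : H →ₗ.[ℂ] H} {z : ℂ} (hz : z ∈ essNumRange T) :
    -z ∈ essNumRange (-T) := by
  obtain ⟨x, h1, h2, h3⟩ := hz
  refine ⟨x, h1, h2, ?_⟩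
  refine h3.neg.congr fun n => ?_
  rw [LinearPMap.neg_apply, inner_neg_right]

theorem essSpec_neg_mem {T : H →ₗ.[ℂ] H} {z : ℂ} (hz : z ∈ essSpec T) :
    -z ∈ essSpec (-T) := by
  obtain ⟨x, h1, h2, h3⟩ := hz
  refine ⟨x, h1, h2, ?_⟩
  refine h3.congr fun n => ?_
  rw [LinearPMap.neg_apply, ← norm_neg]
  congr 1
  rw [neg_smul]; abel

theorem essNumRange_neg (T : H →ₗ.[ℂ] H) : essNumRange (-T) = -essNumRange T := by
  ext z
  constructor
  · intro h
    have := essNumRange_neg_mem h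
    rwa [neg_neg] at this
  · intro h
    have := essNumRange_neg_mem (Set.mem_neg.mp h)
    rwa [neg_neg] at this

theorem essSpec_neg (T : H →ₗ.[ℂ] H) : essSpec (-T) = -essSpec T := by
  ext z
  constructor
  · intro h
    have := essSpec_neg_mem h
    rwa [neg_neg] at this
  · intro h
    have := essSpec_neg_mem (Set.mem_neg.mp h)
    rwa [neg_neg] at this

theorem WeakNull.comp_strictMono {x : ℕ → H} (hx : WeakNull x) {φ : ℕ → ℕ} (hφ : StrictMono φ) :
    WeakNull (fun n => x (φ n)) := fun y => (hx y).comp hφ.tendsto_atTop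

theorem weakNull_clm {x : ℕ → H} (hx : WeakNull x) (R : H →L[ℂ] H) :
    WeakNull (fun n => R (x n)) := by
  intro y
  refine (hx (R.adjoint y)).congr fun n => ?_
  rw [ContinuousLinearMap.adjoint_inner_right]

theorem weakNull_smul {x : ℕ → H} (hx : WeakNull x) (a : ℕ → ℂ) (C : ℝ) (ha : ∀ n, ‖a n‖ ≤ C) :
    WeakNull (fun n => a n • x n) := by
  intro y
  rw [tendsto_zero_iff_norm_tendsto_zero]
  have h := (tendsto_zero_iff_norm_tendsto_zero.mp (hx y)).const_mul C
  rw [mul_zero] at h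
  refine squeeze_zero (fun n => norm_nonneg _) (fun n => ?_) h
  rw [inner_smul_left, norm_mul, RCLike.norm_conj]
  exact mul_le_mul_of_nonneg_right (ha n) (norm_nonneg _)

theorem weakNull_sub {x y : ℕ → H} (hx : WeakNull x) (hy : WeakNull y) :
    WeakNull (fun n => x n - y n) := by
  intro z
  have := (hx z).sub (hy z)
  simpa [inner_sub_left] using this

/-- Quadratic form of a bounded operator. -/
def qb (R : H →L[ℂ] H) (x : H) : ℝ := (inner ℂ x (R x) : ℂ).re

theorem abs_qb_le (R : H →L[ℂ] H) (x : H) : |qb R x| ≤ ‖R‖ * ‖x‖ ^ 2 := by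
  refine (Complex.abs_re_le_norm _).trans ((norm_inner_le_norm _ _).trans ?_)
  have := R.le_opNorm x
  nlinarith [norm_nonneg x]

/-- Essential numerical range of a bounded operator, real parts. -/
def Qset (R : H →L[ℂ] H) : Set ℝ :=
  {r | ∃ x : ℕ → H, (∀ n, ‖x n‖ = 1) ∧ WeakNull x ∧ Tendsto (fun n => qb R (x n)) atTop (𝓝 r)}

theorem Qset_eq (R : H →L[ℂ] H) (hR : ∀ x y : H, (inner ℂ (R x) y : ℂ) = inner ℂ x (R y)) :
    Qset R = (fun r : ℝ => (r : ℂ)) ⁻¹' essNumRange ((R : H →ₗ[ℂ] H).toPMap ⊤) := by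
  have hq : ∀ x : H, (inner ℂ x (R x) : ℂ) = (qb R x : ℂ) := by
    intro x
    have h1 := hR x x
    rw [← inner_conj_symm] at h1
    exact (Complex.conj_eq_iff_re.mp h1).symm
  ext r
  constructor
  · rintro ⟨x, h1, h2, h3⟩
    refine ⟨fun n => ⟨x n, trivial⟩, h1, h2, ?_⟩
    refine ((Complex.continuous_ofReal.tendsto r).comp h3).congr fun n => ?_
    exact (hq (x n)).symm
  · rintro ⟨x, h1, h2, h3⟩
    refine ⟨fun n => x n, h1, h2, ?_⟩
    exact (Complex.continuous_re.tendsto _).comp h3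

theorem Qset_of_seq (R : H →L[ℂ] H) (x : ℕ → H) (h1 : ∀ n, ‖x n‖ = 1) (h2 : WeakNull x) (a : ℝ)
    (h3 : ∃ᶠ n in atTop, a ≤ qb R (x n)) : ∃ r ∈ Qset R, a ≤ r := by
  obtain ⟨φ, hφ, hφ2⟩ := extraction_of_frequently_atTop h3
  have hbd : ∀ n, qb R (x (φ n)) ∈ Set.Icc (-‖R‖) ‖R‖ := by
    intro n
    have := abs_qb_le R (x (φ n))
    rw [h1, one_pow, mul_one] at this
    exact abs_le.mp this
  obtain ⟨r, -, ψ, hψ, hlim⟩ := tendsto_subseq_of_bounded (Metric.isBounded_Icc (-‖R‖) ‖R‖) hbd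
  refine ⟨r, ⟨fun n => x (φ (ψ n)), fun n => h1 _, h2.comp_strictMono (hφ.comp hψ), hlim⟩, ?_⟩
  exact ge_of_tendsto' hlim (fun n => hφ2 _)

/-- The top of the essential numerical range of a bounded selfadjoint operator is in its
essential spectrum. -/
theorem exists_weyl_bounded [TopologicalSpace.SeparableSpace H] (R : H →L[ℂ] H)
    (hR : ∀ x y : H, (inner ℂ (R x) y : ℂ) = inner ℂ x (R y)) {r₀ : ℝ} (hr₀ : r₀ ∈ Qset R) :
    ∃ M : ℝ, r₀ ≤ M ∧ ∃ u : ℕ → H, (∀ n, ‖u n‖ = 1) ∧ WeakNull u ∧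
      Tendsto (fun n => ‖R (u n) - (M : ℂ) • u n‖) atTop (𝓝 0) := by
  have hcl : IsClosed (Qset R) := by
    rw [Qset_eq R hR]
    exact (isClosed_essNumRange _).preimage Complex.continuous_ofReal
  have hbdd : BddAbove (Qset R) := by
    refine ⟨‖R‖, ?_⟩
    rintro r ⟨x, h1, -, h3⟩
    refine le_of_tendsto' h3 fun n => ?_
    have := abs_qb_le R (x n)
    rw [h1, one_pow, mul_one] at this
    exact (abs_le.mp this).2
  set M := sSup (Qset R) with hM
  have hMQ : M ∈ Qset R := hcl.csSup_mem ⟨r₀, hr₀⟩ hbdd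
  refine ⟨M, le_csSup hbdd hr₀, ?_⟩
  obtain ⟨u, hu1, hu2, hu3⟩ := hMQ
  refine ⟨u, hu1, hu2, ?_⟩
  set S : H →L[ℂ] H := (M : ℂ) • ContinuousLinearMap.id ℂ H - R with hS
  have hSap : ∀ x, S x = (M : ℂ) • x - R x := fun x => by simp [hS]
  have hSsym : ∀ x y : H, (inner ℂ (S x) y : ℂ) = inner ℂ x (S y) := by
    intro x y
    rw [hSap, hSap, inner_sub_left, inner_sub_right, inner_smul_left, inner_smul_right, hR,
      Complex.conj_ofReal]
  have hqS : ∀ x, qb S x = M * ‖x‖ ^ 2 - qb R x := by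
    intro x
    unfold qb
    rw [hSap, inner_sub_right, inner_smul_right, inner_self_eq_norm_sq_to_K, Complex.sub_re,
      Complex.re_ofReal_mul, ← RCLike.ofReal_pow]
    congr 2
  have hpos : ∀ (v : ℕ → H) (C : ℝ), 0 < C → (∀ n, ‖v n‖ ≤ C) → WeakNull v → ∀ ε : ℝ, 0 < ε →
      ∀ᶠ n in atTop, -ε ≤ qb S (v n) := by
    intro v C hC hv hvw ε hε
    by_contra hcon
    rw [Filter.not_eventually] at hcon
    obtain ⟨φ, hφ, hφ2⟩ := extraction_of_frequently_atTop hcon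
    push Not at hφ2
    set w : ℕ → H := fun n => v (φ n) with hw
    have hw2 : ∀ n, ε < ‖S‖ * ‖w n‖ ^ 2 := fun n => by
      have := (abs_le.mp (abs_qb_le S (w n))).1
      have := hφ2 n
      linarith
    have hSpos : 0 < ‖S‖ := by
      by_contra h0
      have h1 := hw2 0
      have h2 : ‖S‖ = 0 := le_antisymm (not_lt.mp h0) (norm_nonneg _)
      rw [h2, zero_mul] at h1
      linarith
    have hwpos : ∀ n, 0 < ‖w n‖ := by
      intro n
      by_contra h0
      have h1 : ‖w n‖ = 0 := le_antisymm (not_lt.mp h0) (norm_nonneg _)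
      have := hw2 n
      rw [h1] at this
      norm_num at this
      linarith
    have hinv : ∀ n, ‖(((‖w n‖⁻¹ : ℝ) : ℂ))‖ ≤ Real.sqrt (‖S‖ / ε) := by
      intro n
      rw [Complex.norm_real, norm_inv, norm_norm]
      apply Real.le_sqrt_of_sq_le
      rw [inv_pow, inv_le_comm₀ (by have := hwpos n; positivity) (by positivity), inv_div,
        div_le_iff₀ hSpos]
      linarith [hw2 n]
    have hwn : WeakNull (fun n => ((‖w n‖⁻¹ : ℝ) : ℂ) • w n) :=
      weakNull_smul (hvw.comp_strictMono hφ) _ _ hinv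
    have hge : ∀ n, M + ε / C ^ 2 ≤ qb R (((‖w n‖⁻¹ : ℝ) : ℂ) • w n) := by
      intro n
      have e : qb R (((‖w n‖⁻¹ : ℝ) : ℂ) • w n) = (‖w n‖⁻¹) ^ 2 * qb R (w n) := by
        unfold qb
        rw [map_smul, inner_smul_left, inner_smul_right, Complex.conj_ofReal,
          Complex.re_ofReal_mul, Complex.re_ofReal_mul]
        ring
      rw [e, inv_pow, inv_mul_eq_div, le_div_iff₀ (by have := hwpos n; positivity)]
      have h1 := hφ2 n
      have h1' : qb S (w n) < -ε := h1
      rw [hqS] at h1'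
      have h2 : ‖w n‖ ^ 2 ≤ C ^ 2 := pow_le_pow_left₀ (norm_nonneg _) (hv _) 2
      have h3 : ε / C ^ 2 * ‖w n‖ ^ 2 ≤ ε := by
        rw [div_mul_eq_mul_div, div_le_iff₀ (by positivity)]
        exact mul_le_mul_of_nonneg_left h2 hε.le
      linarith
    obtain ⟨r, hr, hr2⟩ := Qset_of_seq R _ (fun n => by
      have := hwpos n
      simp [norm_smul, this.ne']) hwn _ (Frequently.of_forall hge)
    have := le_csSup hbdd hr
    have : 0 < ε / C ^ 2 := by positivity
    linarith
  have hSu0 : Tendsto (fun n => qb S (u n)) atTop (𝓝 0) := by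
    have := hu3.const_sub M
    rw [sub_self] at this
    refine this.congr fun n => ?_
    rw [hqS, hu1]; ring
  have hSub : ∀ n, ‖S (u n)‖ ≤ ‖S‖ := fun n => by
    have := S.le_opNorm (u n); rwa [hu1, mul_one] at this
  set K := ‖S‖ * ‖S‖ ^ 2 with hK
  have hK0 : 0 ≤ K := by positivity
  have hmain : ∀ t : ℝ, 0 < t → ∀ᶠ n in atTop, ‖S (u n)‖ ^ 2 ≤ t * (2 + K) := by
    intro t ht
    have hwn : WeakNull (fun n => u n - (t : ℂ) • S (u n)) :=
      weakNull_sub hu2 (weakNull_smul (weakNull_clm hu2 S) (fun _ => (t : ℂ)) t (fun n => by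
        rw [Complex.norm_real, Real.norm_eq_abs, abs_of_pos ht]))
    have hev := hpos _ (1 + t * ‖S‖) (by positivity) (fun n => by
      refine (norm_sub_le _ _).trans ?_
      rw [hu1, norm_smul, Complex.norm_real, Real.norm_eq_abs, abs_of_pos ht]
      have := mul_le_mul_of_nonneg_left (hSub n) ht.le
      linarith) hwn (t ^ 2) (by positivity)
    have hev2 : ∀ᶠ n in atTop, qb S (u n) < t ^ 2 := hSu0.eventually_lt_const (by positivity)
    filter_upwards [hev, hev2] with n h1 h2
    have e : qb S (u n - (t : ℂ) • S (u n)) =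
        qb S (u n) - 2 * t * ‖S (u n)‖ ^ 2 + t ^ 2 * qb S (S (u n)) := by
      have e1 : (inner ℂ (u n) (S (S (u n))) : ℂ) = inner ℂ (S (u n)) (S (u n)) :=
        (hSsym _ _).symm
      have e2 : (inner ℂ (S (u n)) (S (u n)) : ℂ).re = ‖S (u n)‖ ^ 2 := by
        rw [inner_self_eq_norm_sq_to_K, ← RCLike.ofReal_pow]
        exact Complex.ofReal_re _
      unfold qb
      rw [map_sub, map_smul, inner_sub_left, inner_sub_right, inner_sub_right, inner_smul_left,
        inner_smul_left, inner_smul_right, inner_smul_right, Complex.conj_ofReal, e1]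
      simp only [Complex.sub_re, Complex.re_ofReal_mul, e2]
      ring
    rw [e] at h1
    have h3 : qb S (S (u n)) ≤ K := by
      refine (abs_le.mp (abs_qb_le S (S (u n)))).2.trans ?_
      have := pow_le_pow_left₀ (norm_nonneg _) (hSub n) 2
      exact mul_le_mul_of_nonneg_left this (norm_nonneg _)
    have h4 : t ^ 2 * qb S (S (u n)) ≤ t ^ 2 * K := mul_le_mul_of_nonneg_left h3 (by positivity)
    have h5 : t * (2 * ‖S (u n)‖ ^ 2) ≤ t * (t * (2 + K)) := by nlinarith
    have h6 := le_of_mul_le_mul_left h5 ht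
    nlinarith [sq_nonneg ‖S (u n)‖]
  have hSlim : Tendsto (fun n => ‖S (u n)‖ ^ 2) atTop (𝓝 0) := by
    rw [Metric.tendsto_nhds]
    intro ε hε
    filter_upwards [hmain (ε / 2 / (2 + K)) (by positivity)] with n hn
    rw [div_mul_cancel₀ _ (by positivity)] at hn
    rw [Real.dist_eq, sub_zero, abs_of_nonneg (by positivity)]
    linarith
  have := hSlim.sqrt
  rw [Real.sqrt_zero] at this
  refine this.congr fun n => ?_
  rw [Real.sqrt_sq (norm_nonneg _), hSap, norm_sub_rev]

/-- The resolvent of a semibounded selfadjoint operator. -/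
theorem exists_resolvent {T : H →ₗ.[ℂ] H} (hs : SymmOp T) (hm : MaxOp T) (b : ℝ)
    (hb : ∀ x : T.domain, ‖(x : H)‖ ^ 2 ≤ qf T x + b * ‖(x : H)‖ ^ 2) :
    ∃ R : H →L[ℂ] H, ∀ y : H, ∃ h : R y ∈ T.domain, T ⟨R y, h⟩ + (b : ℂ) • R y = y := by
  set B : T.domain →ₗ[ℂ] H := T.toFun + (b : ℂ) • T.domain.subtype with hB
  have hBap : ∀ x : T.domain, B x = T x + (b : ℂ) • (x : H) := fun x => rfl
  have hbelow : ∀ x : T.domain, ‖(x : H)‖ ≤ ‖B x‖ := by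
    intro x
    have e : (inner ℂ (x : H) (B x) : ℂ).re = qf T x + b * ‖(x : H)‖ ^ 2 := by
      rw [hBap, inner_add_right, inner_smul_right, inner_self_eq_norm_sq_to_K, Complex.add_re,
        Complex.re_ofReal_mul, ← RCLike.ofReal_pow]
      congr 2
    have h1 : ‖(x : H)‖ ^ 2 ≤ ‖(x : H)‖ * ‖B x‖ := by
      refine (hb x).trans ?_
      rw [← e]
      exact (Complex.re_le_norm _).trans (norm_inner_le_norm _ _)
    by_contra hcon
    push Not at hcon
    have : 0 < ‖(x : H)‖ := lt_of_le_of_lt (norm_nonneg _) hcon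
    nlinarith
  have hinj : Function.Injective B := by
    rw [← LinearMap.ker_eq_bot, LinearMap.ker_eq_bot']
    intro x hx
    have := hbelow x
    rw [hx, norm_zero] at this
    exact Subtype.ext (norm_le_zero_iff.mp this)
  have hclosed : IsClosed (LinearMap.range B : Set H) := by
    apply IsSeqClosed.isClosed
    intro y y₀ hy hlim
    choose x hx using hy
    have hcau : CauchySeq (fun n => ((x n : T.domain) : H)) := by
      rw [Metric.cauchySeq_iff']
      intro ε hε
      obtain ⟨N, hN⟩ := (Metric.cauchySeq_iff'.mp hlim.cauchySeq) ε hε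
      refine ⟨N, fun n hn => lt_of_le_of_lt ?_ (hN n hn)⟩
      rw [dist_eq_norm, dist_eq_norm, ← hx n, ← hx N, ← map_sub]
      exact hbelow (x n - x N)
    obtain ⟨x₀, hx₀⟩ := cauchySeq_tendsto_of_complete hcau
    have hT : Tendsto (fun n => T (x n)) atTop (𝓝 (y₀ - (b : ℂ) • x₀)) := by
      refine (hlim.sub (hx₀.const_smul (b : ℂ))).congr fun n => ?_
      rw [← hx n, hBap, add_sub_cancel_right]
    obtain ⟨h, hT'⟩ := hm x₀ (y₀ - (b : ℂ) • x₀) (fun z => by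
      have l1 : Tendsto (fun n => (inner ℂ (T (x n)) (z : H) : ℂ)) atTop
        (𝓝 (inner ℂ (y₀ - (b : ℂ) • x₀) (z : H))) := hT.inner tendsto_const_nhds
      have l2 : Tendsto (fun n => (inner ℂ ((x n : T.domain) : H) (T z) : ℂ)) atTop
        (𝓝 (inner ℂ x₀ (T z))) := hx₀.inner tendsto_const_nhds
      exact tendsto_nhds_unique l1 (l2.congr fun n => (hs (x n) z).symm))
    exact ⟨⟨x₀, h⟩, by rw [hBap, hT', sub_add_cancel]⟩
  have hsurj : LinearMap.range B = ⊤ := by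
    have : CompleteSpace (LinearMap.range B) := hclosed.completeSpace_coe
    rw [← Submodule.orthogonal_eq_bot_iff, Submodule.eq_bot_iff]
    intro y hy
    rw [Submodule.mem_orthogonal'] at hy
    obtain ⟨h, hT⟩ := hm y (-((b : ℂ) • y)) (fun x => by
      have := hy (B x) ⟨x, rfl⟩
      rw [hBap, inner_add_right, inner_smul_right] at this
      rw [inner_neg_left, inner_smul_left, Complex.conj_ofReal]
      exact (eq_neg_of_add_eq_zero_left this).symm)
    have := hbelow ⟨y, h⟩
    rw [hBap, hT, neg_add_cancel, norm_zero] at this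
    exact norm_le_zero_iff.mp this
  let E : T.domain ≃ₗ[ℂ] H := LinearEquiv.ofBijective B ⟨hinj, LinearMap.range_eq_top.mp hsurj⟩
  have hE : ∀ y, B (E.symm y) = y := fun y => E.apply_symm_apply y
  let R : H →L[ℂ] H := LinearMap.mkContinuous (T.domain.subtype ∘ₗ E.symm.toLinearMap) 1 (by
    intro y
    rw [one_mul]
    have := hbelow (E.symm y)
    rw [hE] at this
    exact this)
  refine ⟨R, fun y => ⟨(E.symm y).2, ?_⟩⟩
  exact hE y

/-- Key: below each point of the essential numerical range there is essential spectrum. -/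
theorem exists_essSpec_le [TopologicalSpace.SeparableSpace H] {T : H →ₗ.[ℂ] H} (hs : SymmOp T)
    (hm : MaxOp T) (hbb : BddBelow (realNumRange T)) {z : ℂ} (hz : z ∈ essNumRange T) :
    ∃ w ∈ essSpec T, w.re ≤ z.re := by
  obtain ⟨c, hc⟩ := hbb
  have hl := qf_lower (T := T) (c := c) (fun r hr => hc hr)
  set b := 1 - c with hb
  have hb1 : ∀ x : T.domain, ‖(x : H)‖ ^ 2 ≤ qf T x + b * ‖(x : H)‖ ^ 2 := fun x => by
    have := hl x
    rw [hb]; linarith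
  obtain ⟨R, hR⟩ := exists_resolvent hs hm b hb1
  choose hRd hRT using hR
  have hRsym : ∀ x y : H, (inner ℂ (R x) y : ℂ) = inner ℂ x (R y) := by
    intro x y
    have h1 := hs ⟨R x, hRd x⟩ ⟨R y, hRd y⟩
    conv_lhs => rw [← hRT y]
    conv_rhs => rw [← hRT x]
    rw [inner_add_right, inner_add_left, inner_smul_left, inner_smul_right, Complex.conj_ofReal,
      h1]
  obtain ⟨x, hx1, hx2, hx3⟩ := hz
  have hq : Tendsto (fun n => qf T (x n) + b) atTop (𝓝 (z.re + b)) :=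
    ((Complex.continuous_re.tendsto z).comp hx3).add_const b
  have hq1 : ∀ n, 1 ≤ qf T (x n) + b := fun n => by
    have := hb1 (x n); rw [hx1] at this; linarith
  have hzb : 1 ≤ z.re + b := ge_of_tendsto' hq hq1
  have hqR : ∀ n, (qf T (x n) + b)⁻¹ ≤ qb R (x n) := by
    intro n
    set y : T.domain := ⟨R (x n), hRd (x n)⟩ with hy
    have h := cs_form hs b (fun u => (sq_nonneg _).trans (hb1 u)) y (x n)
    have e1 : (inner ℂ (T y) ((x n : T.domain) : H) : ℂ).re +
        b * (inner ℂ (y : H) ((x n : T.domain) : H) : ℂ).re = 1 := by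
      have : (inner ℂ (T y + (b : ℂ) • R (x n)) ((x n : T.domain) : H) : ℂ) = 1 := by
        rw [hRT, inner_self_eq_norm_sq_to_K, hx1]; simp
      rw [inner_add_left, inner_smul_left, Complex.conj_ofReal] at this
      have := congrArg Complex.re this
      rwa [Complex.add_re, Complex.re_ofReal_mul, Complex.one_re] at this
    have e2 : qf T y + b * ‖(y : H)‖ ^ 2 = qb R (x n) := by
      have h3 : (inner ℂ (R (x n)) (T y + (b : ℂ) • R (x n)) : ℂ) =
        inner ℂ ((x n : T.domain) : H) (R (x n)) := by rw [hRT, hRsym]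
      have h4 := congrArg Complex.re h3
      rw [inner_add_right, inner_smul_right, inner_self_eq_norm_sq_to_K, Complex.add_re,
        Complex.re_ofReal_mul, ← RCLike.ofReal_pow] at h4
      exact h4
    rw [e1, e2, hx1, one_pow, mul_one] at h
    rw [inv_le_iff_one_le_mul₀ (by linarith [hq1 n])]
    exact h
  -- a point of Qset above (z.re + b)⁻¹
  have hbd : ∀ n, qb R (x n) ∈ Set.Icc (-‖R‖) ‖R‖ := by
    intro n
    have := abs_qb_le R (x n)
    rw [hx1, one_pow, mul_one] at this
    exact abs_le.mp this
  obtain ⟨r, -, ψ, hψ, hlim⟩ := tendsto_subseq_of_bounded (Metric.isBounded_Icc (-‖R‖) ‖R‖) hbd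
  have hrQ : r ∈ Qset R := ⟨fun n => x (ψ n), fun n => hx1 _, hx2.comp_strictMono hψ, hlim⟩
  have hr : (z.re + b)⁻¹ ≤ r :=
    le_of_tendsto_of_tendsto' ((hq.inv₀ (by linarith)).comp hψ.tendsto_atTop) hlim
      (fun n => hqR _)
  obtain ⟨M, hM, u, hu1, hu2, hu3⟩ := exists_weyl_bounded R hRsym hrQ
  have hMz : (z.re + b)⁻¹ ≤ M := hr.trans hM
  have hM0 : 0 < M := lt_of_lt_of_le (by have : 0 < z.re + b := by linarith
                                         positivity) hMz
  have hnorm : Tendsto (fun n => ‖R (u n)‖) atTop (𝓝 M) := by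
    rw [tendsto_iff_norm_sub_tendsto_zero]
    refine squeeze_zero (fun n => norm_nonneg _) (fun n => ?_) hu3
    have : ‖(M : ℂ) • u n‖ = M := by
      rw [norm_smul, hu1, Complex.norm_real, Real.norm_eq_abs, abs_of_pos hM0, mul_one]
    conv_lhs => rw [← this]
    exact abs_norm_sub_norm_le _ _
  obtain ⟨N, hN⟩ := eventually_atTop.mp (hnorm.eventually_const_lt (half_lt_self hM0))
  have hNpos : ∀ n, M / 2 < ‖R (u (n + N))‖ := fun n => hN _ (by omega)
  have hNpos' : ∀ n, 0 < ‖R (u (n + N))‖ := fun n => lt_trans (by positivity) (hNpos n)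
  refine ⟨((M⁻¹ - b : ℝ) : ℂ), ⟨fun n => ((‖R (u (n + N))‖⁻¹ : ℝ) : ℂ) •
    ⟨R (u (n + N)), hRd _⟩, fun n => ?_, ?_, ?_⟩, ?_⟩
  · have := hNpos' n
    simp [norm_smul, this.ne']
  · have hw : WeakNull (fun n => R (u (n + N))) :=
      weakNull_clm (hu2.comp_strictMono (φ := fun n => n + N) (strictMono_id.add_const N)) R
    refine weakNull_smul hw _ (2 / M) (fun n => ?_)
    rw [Complex.norm_real, norm_inv, norm_norm, inv_le_comm₀ (hNpos' n) (by positivity), inv_div]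
    exact (hNpos n).le
  · have hlim2 : Tendsto (fun n => (2 / M * M⁻¹) * ‖R (u (n + N)) - (M : ℂ) • u (n + N)‖) atTop
        (𝓝 0) := by
      have := ((tendsto_add_atTop_iff_nat N).mpr hu3).const_mul (2 / M * M⁻¹)
      rwa [mul_zero] at this
    refine squeeze_zero (fun n => norm_nonneg _) (fun n => ?_) hlim2
    set v := u (n + N) with hv
    have hTv : T ⟨R v, hRd v⟩ = v - (b : ℂ) • R v := eq_sub_of_add_eq (hRT v)
    have hMc : (M : ℂ) ≠ 0 := Complex.ofReal_ne_zero.mpr hM0.ne'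
    have e : T (((‖R v‖⁻¹ : ℝ) : ℂ) • ⟨R v, hRd v⟩) - ((M⁻¹ - b : ℝ) : ℂ) •
        (((((‖R v‖⁻¹ : ℝ) : ℂ) • ⟨R v, hRd v⟩ : T.domain)) : H) =
        (-((‖R v‖⁻¹ : ℝ) : ℂ) * (M : ℂ)⁻¹) • (R v - (M : ℂ) • v) := by
      rw [LinearPMap.map_smul, hTv, Submodule.coe_smul]
      push_cast
      have : v = ((M : ℂ)⁻¹ * (M : ℂ)) • v := by rw [inv_mul_cancel₀ hMc, one_smul]
      conv_lhs => enter [1, 2, 1]; rw [this]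
      module
    rw [e, norm_smul]
    refine mul_le_mul_of_nonneg_right ?_ (norm_nonneg _)
    rw [norm_mul, norm_neg, norm_inv (M : ℂ), Complex.norm_real, Complex.norm_real, norm_inv,
      norm_norm, Real.norm_eq_abs, abs_of_pos hM0]
    refine mul_le_mul_of_nonneg_right ?_ (by positivity)
    rw [inv_le_comm₀ (hNpos' n) (by positivity), inv_div]
    exact (hNpos n).le
  · rw [Complex.ofReal_re]
    have := inv_le_of_inv_le₀ (by linarith) hMz
    linarith

theorem case_b [TopologicalSpace.SeparableSpace H] {T : H →ₗ.[ℂ] H} (hs : SymmOp T)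
    (hm : MaxOp T) (hdense : Dense (T.domain : Set H))
    (hunbounded : ¬∃ C : ℝ, ∀ x : T.domain, ‖T x‖ ≤ C * ‖(x : H)‖)
    (hbb : BddBelow (realNumRange T)) :
    (((essSpec T).Nonempty →
        essNumRange T =
          {z : ℂ | z.im = 0 ∧ sInf (Complex.re '' essSpec T) ≤ z.re}) ∧
      (essSpec T = ∅ → essNumRange T = ∅)) := by
  have hub : ¬ BddAbove (realNumRange T) := fun h => hunbounded (bounded_of_bdd hs hdense hbb h)
  have hbdd : BddBelow (Complex.re '' essSpec T) := by
    obtain ⟨c, hc⟩ := hbb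
    refine ⟨c, ?_⟩
    rintro _ ⟨w, hw, rfl⟩
    exact essNumRange_lower (fun r hr => hc hr) (essSpec_subset T hw)
  refine ⟨fun hne => ?_, fun hempty => ?_⟩
  · apply Set.Subset.antisymm
    · intro z hz
      obtain ⟨w, hw, hwz⟩ := exists_essSpec_le hs hm hbb hz
      exact ⟨essNumRange_im hs hz, (csInf_le hbdd ⟨w, hw, rfl⟩).trans hwz⟩
    · rintro z ⟨hz1, hz2⟩
      have hzz : z = (z.re : ℂ) := Complex.ext rfl hz1
      have hgt : ∀ μ : ℝ, z.re < μ → (μ : ℂ) ∈ essNumRange T := by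
        intro μ hμ
        obtain ⟨_, ⟨w, hw, rfl⟩, hwμ⟩ := exists_lt_of_csInf_lt (hne.image _)
          (lt_of_le_of_lt hz2 hμ)
        exact essNumRange_up hs hub (essSpec_subset T hw) hwμ.le
      have hlim : Tendsto (fun n : ℕ => ((z.re + 1 / ((n : ℝ) + 1) : ℝ) : ℂ)) atTop (𝓝 z) := by
        rw [hzz]
        refine (Complex.continuous_ofReal.tendsto _).comp ?_
        have := (tendsto_one_div_add_atTop_nhds_zero_nat (𝕜 := ℝ)).const_add z.re
        simpa using this
      exact (isClosed_essNumRange T).mem_of_tendsto hlim (Eventually.of_forall fun n =>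
        hgt _ (by have : (0 : ℝ) < 1 / ((n : ℝ) + 1) := by positivity
                  linarith))
  · rw [Set.eq_empty_iff_forall_notMem]
    intro z hz
    obtain ⟨w, hw, -⟩ := exists_essSpec_le hs hm hbb hz
    rw [hempty] at hw
    exact hw

theorem case_a [TopologicalSpace.SeparableSpace H] (hinf : ¬FiniteDimensional ℂ H)
    {T : H →ₗ.[ℂ] H} (hs : SymmOp T) (hdense : Dense (T.domain : Set H))
    (h1 : ¬BddBelow (realNumRange T)) (h2 : ¬BddAbove (realNumRange T)) :
    essNumRange T = {z : ℂ | z.im = 0} := by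
  apply Set.Subset.antisymm
  · exact fun z hz => essNumRange_im hs hz
  · intro z hz
    have hzz : z = (z.re : ℂ) := Complex.ext rfl hz
    rw [hzz]
    apply mem_of_perturb hs
    intro F ε hε
    obtain ⟨x, hx1, hx2⟩ := exists_almost_orth hinf hdense F ε hε
    refine ⟨x, hx2, fun δ hδ => ?_⟩
    rcases le_total (qf T x) z.re with h | h
    · obtain ⟨w, hw1, hw2, hw3⟩ := perturb hs h2 x hx1 z.re h δ hδ
      exact ⟨w, hw1, hw2, by linarith⟩
    · have h2' : ¬ BddAbove (realNumRange (-T)) := by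
        rw [realNumRange_neg, bddAbove_neg]; exact h1
      have hqn : ∀ y : T.domain, qf (-T) y = -qf T y := fun y => by
        unfold qf
        rw [LinearPMap.neg_apply, inner_neg_right, Complex.neg_re]
      obtain ⟨w, hw1, hw2, hw3⟩ := perturb (symm_neg hs) h2' x hx1 (-z.re)
        (by rw [hqn]; linarith) δ hδ
      refine ⟨w, hw1, hw2, ?_⟩
      rw [hqn, ← abs_neg] at hw3
      have e : -(-qf T w - -z.re) = qf T w - z.re := by ring
      rw [e] at hw3
      linarith

/-- Theorem 3.8: for an unbounded selfadjoint operator `T`,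
`W_e(T) = conv(σ̂_e(T)) \ {±∞}`, spelled out in the three cases. -/
theorem essNumRange_of_selfadjoint_unbounded
    [TopologicalSpace.SeparableSpace H] (hinf : ¬FiniteDimensional ℂ H)
    (T : H →ₗ.[ℂ] H) (hdense : Dense (T.domain : Set H)) (hsa : T.adjoint = T)
    (hunbounded : ¬∃ C : ℝ, ∀ x : T.domain, ‖T x‖ ≤ C * ‖(x : H)‖) :
    ((¬BddBelow (realNumRange T) ∧ ¬BddAbove (realNumRange T)) →
      essNumRange T = {z : ℂ | z.im = 0}) ∧
    (BddBelow (realNumRange T) →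
      (((essSpec T).Nonempty →
        essNumRange T =
          {z : ℂ | z.im = 0 ∧ sInf (Complex.re '' essSpec T) ≤ z.re}) ∧
      (essSpec T = ∅ → essNumRange T = ∅))) ∧
    (BddAbove (realNumRange T) →
      (((essSpec T).Nonempty →
        essNumRange T =
          {z : ℂ | z.im = 0 ∧ z.re ≤ sSup (Complex.re '' essSpec T)}) ∧
      (essSpec T = ∅ → essNumRange T = ∅))) := by
  have hs : SymmOp T := by
    intro x y
    have h := LinearPMap.adjoint_isFormalAdjoint hdense
    rw [hsa] at h
    exact h x y
  have hm : MaxOp T := by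
    intro y w h
    have hy : y ∈ T.adjoint.domain := LinearPMap.mem_adjoint_domain_of_exists y ⟨w, h⟩
    have hT := LinearPMap.adjoint_apply_eq hdense ⟨y, hy⟩ h
    have key : ∀ S : H →ₗ.[ℂ] H, S = T → ∀ hy : y ∈ S.domain, S ⟨y, hy⟩ = w →
        ∃ h : y ∈ T.domain, T ⟨y, h⟩ = w := by
      rintro S rfl hy hS
      exact ⟨hy, hS⟩
    exact key _ hsa hy hT
  refine ⟨fun h => case_a hinf hs hdense h.1 h.2,
    fun h => case_b hs hm hdense hunbounded h, fun h => ?_⟩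
  have hb := case_b (T := -T) (symm_neg hs) (max_neg hm) hdense
    (fun ⟨C, hC⟩ => hunbounded ⟨C, fun x => by
      have := hC x
      rwa [LinearPMap.neg_apply, norm_neg] at this⟩)
    (by rw [realNumRange_neg, bddBelow_neg]; exact h)
  rw [essSpec_neg, essNumRange_neg] at hb
  refine ⟨fun hne => ?_, fun he => ?_⟩
  · have h1 := hb.1 (by simpa using hne)
    have himg : Complex.re '' (-essSpec T) = -(Complex.re '' essSpec T) := by
      ext r
      constructor
      · rintro ⟨w, hw, rfl⟩
        exact ⟨-w, hw, by simp⟩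
      · rintro ⟨w, hw, hr⟩
        exact ⟨-w, by simpa using hw, by simp [hr]⟩
    rw [himg, Real.sInf_def, neg_neg] at h1
    ext z
    have h2 := Set.ext_iff.mp h1 (-z)
    simp only [Set.mem_neg, neg_neg, Set.mem_ofPred_eq, Complex.neg_im, neg_eq_zero,
      Complex.neg_re, neg_le_neg_iff] at h2
    exact h2
  · have h1 := hb.2 (by rw [he]; simp)
    simpa using h1
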